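/- Let d ≥ 2 be even, n ≥ d+2, and let C_d(n) ⊂ ℝ^d be the cyclic polytope with vertices v_i = (t_i, t_i², …, t_i^d) for fixed reals t_1 < … < t_n. Then the normalized realization space ℛ(C_d(n)) (taken with the affine basis B = {1,…,d+1}) is nonempty, open as a subset of the affine subspace {(x_1,…,x_n) ∈ (ℝ^d)^n : x_i = v_i for i ∈ B}, and contractible. -/

import Mathlib

noncomputable section

/-- A primary basic semialgebraic set in `ℝ^m` defined over `ℤ`: the solution set of finitely
many polynomial equalities and *strict* polynomial inequalities with integer coefficients. -/
def IsPrimaryBasicSemialgebraicZ {m : ℕ} (S : Set (Fin m → ℝ)) : Prop :=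
  ∃ (k l : ℕ) (f : Fin k → MvPolynomial (Fin m) ℤ) (g : Fin l → MvPolynomial (Fin m) ℤ),
    S = {x : Fin m → ℝ |
      (∀ i, MvPolynomial.aeval x (f i) = (0 : ℝ)) ∧
      (∀ j, (0 : ℝ) < MvPolynomial.aeval x (g j))}

/-- `S ⊆ ℝ^d` is a stable projection of `T ⊆ ℝ^{d+d'}`: the coordinate projection maps `T`
onto `S`, and over each `x ∈ S` the fiber of `T` is a nonempty set given by linear equalities
and strict linear inequalities in the fiber variables, whose coefficients depend polynomially
on `x` (i.e. the relative interior of a nonempty polyhedron depending polynomially on `x`). -/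
def IsStableProjection {d d' : ℕ} (S : Set (Fin d → ℝ)) (T : Set (Fin (d + d') → ℝ)) : Prop :=
  ∃ (k l : ℕ) (A : Fin k → Fin d' → MvPolynomial (Fin d) ℝ) (b : Fin k → MvPolynomial (Fin d) ℝ)
    (C : Fin l → Fin d' → MvPolynomial (Fin d) ℝ) (c : Fin l → MvPolynomial (Fin d) ℝ),
    (∀ x ∈ S, ∃ y : Fin d' → ℝ, Fin.append x y ∈ T) ∧
    ∀ (x : Fin d → ℝ) (y : Fin d' → ℝ),
      Fin.append x y ∈ T ↔
        x ∈ S ∧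
        (∀ i, (∑ j, MvPolynomial.eval x (A i j) * y j) + MvPolynomial.eval x (b i) = 0) ∧
        (∀ i, 0 < (∑ j, MvPolynomial.eval x (C i j) * y j) + MvPolynomial.eval x (c i))

/-- `f` is coordinatewise a rational function on `S` (denominators nonvanishing on `S`). -/
def IsRationalMapOn {d e : ℕ} (S : Set (Fin d → ℝ)) (f : (Fin d → ℝ) → Fin e → ℝ) : Prop :=
  ∀ i : Fin e, ∃ p q : MvPolynomial (Fin d) ℝ, ∀ x ∈ S,
    MvPolynomial.eval x q ≠ 0 ∧ f x i = MvPolynomial.eval x p / MvPolynomial.eval x q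

/-- `S` and `T` are rationally equivalent: there are mutually inverse bijections between them
which are coordinatewise rational (hence in particular a homeomorphism). -/
def RationallyEquivalent {d e : ℕ} (S : Set (Fin d → ℝ)) (T : Set (Fin e → ℝ)) : Prop :=
  ∃ (f : (Fin d → ℝ) → Fin e → ℝ) (g : (Fin e → ℝ) → Fin d → ℝ),
    IsRationalMapOn S f ∧ IsRationalMapOn T g ∧
    (∀ x ∈ S, f x ∈ T) ∧ (∀ y ∈ T, g y ∈ S) ∧
    (∀ x ∈ S, g (f x) = x) ∧ (∀ y ∈ T, f (g y) = y)

/-- One generating step of stable equivalence: a stable projection (in either direction,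
symmetry being supplied by the generated equivalence) or a rational equivalence. -/
def StableStep (X Y : Σ d : ℕ, Set (Fin d → ℝ)) : Prop :=
  (∃ (d' : ℕ) (T : Set (Fin (X.1 + d') → ℝ)),
      Y = ⟨X.1 + d', T⟩ ∧ IsStableProjection X.2 T) ∨
  RationallyEquivalent X.2 Y.2

/-- Stable equivalence: the equivalence relation generated by stable projections and
rational equivalences. -/
def StablyEquivalent (X Y : Σ d : ℕ, Set (Fin d → ℝ)) : Prop :=
  Relation.EqvGen StableStep X Y

/-- The index of the `c`-th coordinate of the `p`-th point in the flattening
`(ℝ^d)^n ≃ ℝ^{d·n}`. -/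
def flatIdx {n d : ℕ} (p : Fin n) (c : Fin d) : Fin (d * n) :=
  ⟨d * p.1 + c.1, by
    have h1 : d * (p.1 + 1) ≤ d * n := Nat.mul_le_mul le_rfl p.2
    have h2 : d * (p.1 + 1) = d * p.1 + d := by ring
    have h3 := c.2
    omega⟩

/-- Flatten a set of point configurations `(ℝ^d)^n` into a subset of `ℝ^{d·n}`. -/
def flat {n d : ℕ} (R : Set (Fin n → Fin d → ℝ)) : Set (Fin (d * n) → ℝ) :=
  {x | (fun (p : Fin n) (c : Fin d) => x (flatIdx p c)) ∈ R}

/-- `v '' S` is the set of extreme points of some face of the polytope `conv (range v)`;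
the faces of a polytope `Q` are `Q` itself, `∅`, and the exposed faces of `Q`
(`∅` is exposed). -/
def IsVertexSetOfFace {n d : ℕ} (v : Fin n → Fin d → ℝ) (S : Finset (Fin n)) : Prop :=
  ∃ F : Set (Fin d → ℝ),
    (F = convexHull ℝ (Set.range v) ∨ IsExposed ℝ (convexHull ℝ (Set.range v)) F) ∧
    Set.extremePoints ℝ F = v '' ↑S

/-- `v` lists the `n` vertices of a (full-dimensional) polytope in `ℝ^d`: the `v i` are
pairwise distinct, each is an extreme point of their convex hull, and they affinely
span `ℝ^d` (so the polytope has dimension `d`). -/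
def IsPolytopeVertexList {n d : ℕ} (v : Fin n → Fin d → ℝ) : Prop :=
  Function.Injective v ∧
  (∀ i, v i ∈ Set.extremePoints ℝ (convexHull ℝ (Set.range v))) ∧
  affineSpan ℝ (Set.range v) = ⊤

/-- The (normalized) realization space of the polytope with vertex list `v`, with respect to
the affine basis indexed by `B`: labeled point configurations `x` fixing the basis, all of
whose points are vertices of their convex hull, with the same vertex sets of faces as `v`. -/
def polytopeRealizationSpace {n d : ℕ} (v : Fin n → Fin d → ℝ) (B : Finset (Fin n)) :
    Set (Fin n → Fin d → ℝ) :=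
  {x | (∀ i ∈ B, x i = v i) ∧
    (∀ i, x i ∈ Set.extremePoints ℝ (convexHull ℝ (Set.range x))) ∧
    ∀ S : Finset (Fin n), IsVertexSetOfFace x S ↔ IsVertexSetOfFace v S}

/-- A `d`-polytope with vertex list `v` is neighborly if every set of at most `⌊d/2⌋`
vertices is the vertex set of a face. -/
def IsNeighborly {n d : ℕ} (v : Fin n → Fin d → ℝ) : Prop :=
  ∀ S : Finset (Fin n), S.card ≤ d / 2 → IsVertexSetOfFace v S

/-- A polytope is simplicial if all of its proper faces are simplices. -/
def IsSimplicialVertexList {n d : ℕ} (v : Fin n → Fin d → ℝ) : Prop :=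
  ∀ F : Set (Fin d → ℝ), IsExposed ℝ (convexHull ℝ (Set.range v)) F →
    F ≠ convexHull ℝ (Set.range v) →
    ∃ s : Finset (Fin d → ℝ),
      AffineIndependent ℝ (fun x : ↥s => (x : Fin d → ℝ)) ∧ F = convexHull ℝ ↑s

/-- The vector representing the linear functional `z ↦ det (z, u 0, …, u (d - 1))`. -/
def normalVec {d : ℕ} (u : Fin d → Fin (d + 1) → ℝ) : Fin (d + 1) → ℝ :=
  fun j => (-1) ^ (j : ℕ) * (Matrix.of fun i k => u i (j.succAbove k)).det

/-- `S` is the zero set, among the vectors `X i`, of a linear functional that is positive on the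
remaining vectors. -/
def IsFaceSet {n m : ℕ} (X : Fin n → Fin m → ℝ) (S : Finset (Fin n)) : Prop :=
  ∃ w : Fin m → ℝ, ∀ i, (i ∈ S → X i ⬝ᵥ w = 0) ∧ (i ∉ S → 0 < X i ⬝ᵥ w)

/-- All maximal minors with increasing row indices are positive. -/
def IsAlternating {n m : ℕ} (X : Fin n → Fin m → ℝ) : Prop :=
  ∀ σ : Fin m → Fin n, StrictMono σ → 0 < (Matrix.of fun j => X (σ j)).det

/-- Homogeneous coordinates of a point configuration. -/
def homogenize {n d : ℕ} (x : Fin n → Fin d → ℝ) : Fin n → Fin (d + 1) → ℝ :=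
  fun i => Fin.cons 1 (x i)

theorem det_insertNth {d : ℕ} (u : Fin d → Fin (d + 1) → ℝ) (z : Fin (d + 1) → ℝ)
    (p : Fin (d + 1)) :
    (Matrix.of (p.insertNth z u : Fin (d + 1) → Fin (d + 1) → ℝ)).det
      = (-1) ^ (p : ℕ) * (z ⬝ᵥ normalVec u) := by
  rw [Matrix.det_succ_row _ p, dotProduct, Finset.mul_sum]
  refine Finset.sum_congr rfl fun j _ => ?_
  have h : (Matrix.of (p.insertNth z u : Fin (d + 1) → Fin (d + 1) → ℝ)).submatrix
      p.succAbove j.succAbove = Matrix.of fun i k => u i (j.succAbove k) := by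
    ext i k
    simp 
  rw [h, normalVec, pow_add]
  simp only [Matrix.of_apply, Fin.insertNth_apply_same]
  ring

theorem dotProduct_normalVec_self {d : ℕ} (u : Fin d → Fin (d + 1) → ℝ) (i : Fin d) :
    u i ⬝ᵥ normalVec u = 0 := by
  have h := det_insertNth u (u i) 0
  have h0 : (Matrix.of ((0 : Fin (d + 1)).insertNth (u i) u :
      Fin (d + 1) → Fin (d + 1) → ℝ)).det = 0 :=
    Matrix.det_zero_of_row_eq (i := 0) (j := i.succ) (Fin.succ_ne_zero i).symm
      (by ext k; simp)
  rw [h0] at h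
  simpa using h.symm

theorem sum_minors_smul_eq_zero {m : ℕ} (Y : Fin (m + 1) → Fin m → ℝ) (c : Fin m) :
    ∑ i : Fin (m + 1), ((-1) ^ (i : ℕ) * (Matrix.of fun j => Y (i.succAbove j)).det) * Y i c =
      0 := by
  have h := Matrix.det_succ_column_zero
    (Matrix.of (fun i => Fin.cons (Y i c) (Y i) : Fin (m + 1) → Fin (m + 1) → ℝ))
  rw [Matrix.det_zero_of_column_eq (i := 0) (j := c.succ) (Fin.succ_ne_zero c).symm
    (by simp)] at h
  rw [h]
  refine Finset.sum_congr rfl fun i _ => ?_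
  have h' : (Matrix.of (fun i => Fin.cons (Y i c) (Y i) :
      Fin (m + 1) → Fin (m + 1) → ℝ)).submatrix i.succAbove Fin.succ =
      Matrix.of fun j => Y (i.succAbove j) := by
    ext j k
    simp 
  rw [h']
  simp only [Matrix.of_apply, Fin.cons_zero]
  ring

theorem strictMono_insertNth {d n : ℕ} {u : Fin d → Fin n} (hu : StrictMono u) (z : Fin n)
    (p : Fin (d + 1)) (h₁ : ∀ j : Fin d, j.castSucc < p → u j < z)
    (h₂ : ∀ j : Fin d, p ≤ j.castSucc → z < u j) :
    StrictMono (p.insertNth z u : Fin (d + 1) → Fin n) := by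
  intro a b hab
  rcases Fin.eq_self_or_eq_succAbove p a with h | ⟨i, rfl⟩ <;>
  rcases Fin.eq_self_or_eq_succAbove p b with h' | ⟨j, rfl⟩
  · exact absurd hab (by rw [h, h']; exact lt_irrefl _)
  · subst h
    simpa using h₂ j ((Fin.lt_succAbove_iff_le_castSucc _ _).1 hab)
  · subst h'
    simpa using h₁ i ((Fin.succAbove_lt_iff_castSucc_lt _ _).1 hab)
  · simpa using hu ((Fin.strictMono_succAbove p).lt_iff_lt.1 hab)

theorem exists_strictMono_insertNth {d n : ℕ} {u : Fin d → Fin n} (hu : StrictMono u) (z : Fin n)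
    (hz : ∀ j, u j ≠ z) :
    ∃ p : Fin (d + 1), (p : ℕ) = (Finset.univ.filter fun j => u j < z).card ∧
      StrictMono (p.insertNth z u : Fin (d + 1) → Fin n) := by
  have hc : (Finset.univ.filter fun j => u j < z).card < d + 1 :=
    Nat.lt_succ_of_le ((Finset.card_le_univ _).trans (by simp))
  refine ⟨⟨_, hc⟩, rfl, strictMono_insertNth hu z _ (fun j hj => ?_) (fun j hj => ?_)⟩
  · by_contra h
    have : (Finset.univ.filter fun j => u j < z) ⊆ Finset.Iio j := by
      intro i hi
      simp only [Finset.mem_filter, Finset.mem_univ, true_and, Finset.mem_Iio] at hi ⊢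
      exact hu.lt_iff_lt.1 (hi.trans_le (not_lt.1 h))
    have := Finset.card_le_card this
    rw [Fin.card_Iio] at this
    have hj' := Fin.lt_def.1 hj
    simp only [Fin.val_castSucc] at hj'
    omega
  · by_contra h
    have hlt : u j < z := lt_of_le_of_ne (not_lt.1 h) (hz j)
    have : Finset.Iic j ⊆ (Finset.univ.filter fun j => u j < z) := by
      intro i hi
      simp only [Finset.mem_filter, Finset.mem_univ, true_and, Finset.mem_Iic] at hi ⊢
      exact (hu.monotone hi).trans_lt hlt
    have := Finset.card_le_card this
    rw [Fin.card_Iic] at this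
    have hj' := Fin.le_def.1 hj
    simp only [Fin.val_castSucc] at hj'
    omega

theorem IsAlternating.exists_dotProduct_normalVec_pos {n d : ℕ} {X : Fin n → Fin (d + 1) → ℝ}
    (hX : IsAlternating X) {u : Fin d → Fin n} (hu : StrictMono u) (z : Fin n)
    (hz : ∀ j, u j ≠ z) :
    0 < (-1) ^ (Finset.univ.filter fun j => u j < z).card *
      (X z ⬝ᵥ normalVec fun j => X (u j)) := by
  obtain ⟨p, hp, hmono⟩ := exists_strictMono_insertNth hu z hz
  have h := hX _ hmono
  rw [← hp, ← det_insertNth]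
  convert h using 3
  ext a b
  rcases Fin.eq_self_or_eq_succAbove p a with rfl | ⟨i, rfl⟩ <;> simp

theorem IsFaceSet.lt_card_of_dependence {n m N : ℕ} {X : Fin n → Fin (m + 1) → ℝ}
    (h1 : ∀ i, X i 0 = 1) {α : Fin N → Fin n} (hα : Function.Injective α) {c : Fin N → ℝ}
    (hc : c ≠ 0) (hdep : ∀ k, ∑ j, c j * X (α j) k = 0) :
    ¬ IsFaceSet X ((Finset.univ.filter fun j => 0 < c j).image α) := by
  rintro ⟨w, hw⟩
  have hterm : ∀ j, c j * (X (α j) ⬝ᵥ w) ≤ 0 := by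
    intro j
    by_cases hj : 0 < c j
    · rw [(hw (α j)).1 (Finset.mem_image_of_mem _ (by simpa using hj)), mul_zero]
    · refine mul_nonpos_of_nonpos_of_nonneg (not_lt.1 hj) ((hw (α j)).2 ?_).le
      intro hmem
      obtain ⟨i, hi, hij⟩ := Finset.mem_image.1 hmem
      rw [hα hij] at hi
      exact hj (by simpa using hi)
  have hsum : ∑ j, c j * (X (α j) ⬝ᵥ w) = 0 := by
    simp only [dotProduct, Finset.mul_sum]
    rw [Finset.sum_comm]
    refine Finset.sum_eq_zero fun k _ => ?_
    have := congrArg (· * w k) (hdep k)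
    simp only [Finset.sum_mul, zero_mul] at this
    simpa [mul_assoc] using this
  have hzero := (Finset.sum_eq_zero_iff_of_nonpos fun j _ => hterm j).1 hsum
  have hnonneg : ∀ j ∈ Finset.univ, 0 ≤ c j := by
    intro j _
    by_contra hj
    have hpos : 0 < X (α j) ⬝ᵥ w := by
      refine (hw (α j)).2 fun hmem => ?_
      obtain ⟨i, hi, hij⟩ := Finset.mem_image.1 hmem
      rw [hα hij] at hi
      exact hj (by simpa using hi : 0 < c j).le
    exact (mul_neg_of_neg_of_pos (not_le.1 hj) hpos).ne (hzero j (Finset.mem_univ j))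
  have h0 := hdep 0
  simp only [h1, mul_one] at h0
  exact hc (funext fun j => (Finset.sum_eq_zero_iff_of_nonneg hnonneg).1 h0 j (Finset.mem_univ j))

/-- The faces of even-dimensional cyclic polytopes that determine the chirotope: all sets of at
most `k` vertices, and all sets of at most `k + 1` vertices containing two consecutive ones. -/
def HasCyclicFaces {n m : ℕ} (k : ℕ) (X : Fin n → Fin m → ℝ) : Prop :=
  ∀ P : Finset (Fin n), (P.card ≤ k ∨
    P.card ≤ k + 1 ∧ ∃ a ∈ P, ∃ b ∈ P, (b : ℕ) = a + 1) → IsFaceSet X P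

theorem HasCyclicFaces.lt_card {n m N k : ℕ} {X : Fin n → Fin (m + 1) → ℝ}
    (hX : HasCyclicFaces k X)
    (h1 : ∀ i, X i 0 = 1) {α : Fin N → Fin n} (hα : Function.Injective α) {c : Fin N → ℝ}
    (hc : c ≠ 0) (hdep : ∀ k, ∑ j, c j * X (α j) k = 0) :
    k < (Finset.univ.filter fun j => 0 < c j).card ∧
    ((∃ a b, 0 < c a ∧ 0 < c b ∧ (α b : ℕ) = α a + 1) →
      k + 1 < (Finset.univ.filter fun j => 0 < c j).card) := by
  have hnot := IsFaceSet.lt_card_of_dependence h1 hα hc hdep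
  rw [← Finset.card_image_of_injective _ hα]
  constructor
  · by_contra h
    exact hnot (hX _ (Or.inl (not_lt.1 h)))
  · rintro ⟨a, b, ha, hb, hab⟩
    by_contra h
    exact hnot (hX _ (Or.inr ⟨not_lt.1 h, α a, Finset.mem_image_of_mem _ (by simpa using ha),
      α b, Finset.mem_image_of_mem _ (by simpa using hb), hab⟩))

theorem card_pos_add_card_neg_le {N : ℕ} (c : Fin N → ℝ) :
    (Finset.univ.filter fun j => 0 < c j).card + (Finset.univ.filter fun j => 0 < (-c) j).card
      ≤ N := by
  rw [← Finset.card_union_of_disjoint]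
  · exact (Finset.card_le_univ _).trans (by simp)
  · refine Finset.disjoint_filter.2 fun j _ h h' => ?_
    simp only [Pi.neg_apply] at h'
    linarith

theorem HasCyclicFaces.det_ne_zero {n k : ℕ} {X : Fin n → Fin (k + k + 1) → ℝ}
    (hX : HasCyclicFaces k X) (h1 : ∀ i, X i 0 = 1) {σ : Fin (k + k + 1) → Fin n}
    (hσ : Function.Injective σ) : (Matrix.of fun j => X (σ j)).det ≠ 0 := by
  intro h
  obtain ⟨c, hc, hdep⟩ := Matrix.exists_vecMul_eq_zero_iff.2 h
  have hdep' : ∀ l, ∑ j, c j * X (σ j) l = 0 := fun l => by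
    simpa [Matrix.vecMul, dotProduct] using congrFun hdep l
  have h2 : ∀ l, ∑ j, (-c) j * X (σ j) l = 0 := fun l => by
    simpa using hdep' l
  have := (hX.lt_card h1 hσ hc hdep').1
  have := (hX.lt_card h1 hσ (neg_ne_zero.2 hc) h2).1
  have := card_pos_add_card_neg_le c
  omega

theorem HasCyclicFaces.det_mul_det_pos {n k : ℕ} {X : Fin n → Fin (k + k + 1) → ℝ}
    (hX : HasCyclicFaces k X) (h1 : ∀ i, X i 0 = 1) {α : Fin (k + k + 1 + 1) → Fin n}
    (hα : Function.Injective α) (i : Fin (k + k + 1))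
    (hi : (α i.succ : ℕ) = α i.castSucc + 1) :
    0 < (Matrix.of fun j => X (α (i.castSucc.succAbove j))).det *
      (Matrix.of fun j => X (α (i.succ.succAbove j))).det := by
  set c : Fin (k + k + 1 + 1) → ℝ := fun i =>
    (-1) ^ (i : ℕ) * (Matrix.of fun j => X (α (i.succAbove j))).det with hcdef
  have hne : ∀ i, c i ≠ 0 := fun i => mul_ne_zero (by simp)
    (hX.det_ne_zero h1 (hα.comp Fin.succAbove_right_injective))
  have hc : c ≠ 0 := fun h => hne 0 (by rw [h]; rfl)
  have hdep : ∀ l, ∑ j, c j * X (α j) l = 0 :=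
    fun l => sum_minors_smul_eq_zero (fun i => X (α i)) l
  have hdep' : ∀ l, ∑ j, (-c) j * X (α j) l = 0 := fun l => by
    simpa using hdep l
  have hp := hX.lt_card h1 hα hc hdep
  have hn := hX.lt_card h1 hα (neg_ne_zero.2 hc) hdep'
  have hle := card_pos_add_card_neg_le c
  have hneg : c i.castSucc * c i.succ < 0 := by
    rcases lt_or_gt_of_ne (hne i.castSucc) with ha | ha <;>
    rcases lt_or_gt_of_ne (hne i.succ) with hb | hb
    · have := hn.2 ⟨_, _, by simpa using ha, by simpa using hb, hi⟩
      omega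
    · exact mul_neg_of_neg_of_pos ha hb
    · exact mul_neg_of_pos_of_neg ha hb
    · have := hp.2 ⟨_, _, ha, hb, hi⟩
      omega
  have hs : ((-1 : ℝ) ^ (i : ℕ)) * (-1) ^ (i : ℕ) = 1 := by
    rw [← mul_pow]; simp
  simp only [hcdef, Fin.val_castSucc, Fin.val_succ, pow_succ] at hneg
  set A := (Matrix.of fun j => X (α (i.castSucc.succAbove j))).det
  set B := (Matrix.of fun j => X (α (i.succ.succAbove j))).det
  have : (-1 : ℝ) ^ (i : ℕ) * A * ((-1) ^ (i : ℕ) * -1 * B) = -(A * B) := by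
    linear_combination (-(A * B)) * hs
  linarith

/-- Even-dimensional cyclic polytopes are rigid: their faces determine the chirotope. -/
theorem HasCyclicFaces.isAlternating {n k : ℕ} {X : Fin n → Fin (k + k + 1) → ℝ}
    (hX : HasCyclicFaces k X) (h1 : ∀ i, X i 0 = 1)
    (h0 : ∀ σ : Fin (k + k + 1) → Fin n, (∀ j, (σ j : ℕ) = j) →
      0 < (Matrix.of fun j => X (σ j)).det) : IsAlternating X := by
  intro σ hσ
  induction hs : ∑ j, (σ j : ℕ) using Nat.strong_induction_on generalizing σ with
  | _ s ih =>
    by_cases hinit : ∀ j, (σ j : ℕ) = j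
    · exact h0 σ hinit
    have hle : ∀ j : Fin (k + k + 1), (j : ℕ) ≤ σ j := fun j => by
      have hsub : (Finset.Iio j).image (fun a => (σ a : ℕ)) ⊆ Finset.range (σ j) := by
        intro a ha
        obtain ⟨b, hb, rfl⟩ := Finset.mem_image.1 ha
        exact Finset.mem_range.2 (hσ (Finset.mem_Iio.1 hb))
      have := Finset.card_le_card hsub
      rwa [Finset.card_image_of_injective _
        (fun a b h => hσ.injective (Fin.ext h)), Fin.card_Iio, Finset.card_range] at this
    have hex : ∃ a : ℕ, ∃ i : Fin (k + k + 1), (i : ℕ) = a ∧ (i : ℕ) < σ i := by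
      push Not at hinit
      obtain ⟨i, hi⟩ := hinit
      exact ⟨i, i, rfl, lt_of_le_of_ne (hle i) (Ne.symm hi)⟩
    classical
    obtain ⟨i, hia, hi⟩ := Nat.find_spec hex
    have hmin : ∀ j, j < i → (σ j : ℕ) = j := by
      intro j hj
      by_contra h
      have hj' : (j : ℕ) < i := hj
      exact Nat.find_min hex (hia ▸ hj') ⟨j, rfl, lt_of_le_of_ne (hle j) (Ne.symm h)⟩
    let b : Fin n := ⟨σ i - 1, by omega⟩
    have hb : (σ i : ℕ) = b + 1 := by simp only [b]; omega
    let α : Fin (k + k + 1 + 1) → Fin n := i.castSucc.insertNth b σ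
    have hα : StrictMono α := by
      refine strictMono_insertNth hσ b _ (fun j hj => ?_) (fun j hj => ?_)
      · have hj' : j < i := by simpa using hj
        have := hmin j hj'
        have : (j : ℕ) < i := hj'
        rw [Fin.lt_def]; omega
      · have hj' : i ≤ j := by simpa using hj
        have : (σ i : ℕ) ≤ σ j := hσ.monotone hj'
        rw [Fin.lt_def]; omega
    have hα1 : ∀ j, α (i.castSucc.succAbove j) = σ j := fun j => by simp [α]
    have hα0 : α i.castSucc = b := by simp [α]
    have hαs : α i.succ = σ i := by
      rw [← hα1 i, Fin.succAbove_castSucc_self]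
    have hpos := hX.det_mul_det_pos h1 hα.injective i (by rw [hα0, hαs, hb])
    simp only [hα1] at hpos
    have hlt := ih (∑ j, (α (i.succ.succAbove j) : ℕ)) ?_ (fun j => α (i.succ.succAbove j))
      (hα.comp (Fin.strictMono_succAbove _)) rfl
    · exact (pos_iff_pos_of_mul_pos hpos).2 hlt
    · rw [← hs]
      refine Finset.sum_lt_sum (fun j _ => ?_) ⟨i, Finset.mem_univ _, ?_⟩
      · rw [← hα1 j]
        refine hα.monotone ?_
        rw [Fin.le_def]
        simp only [Fin.succAbove, Fin.lt_def, Fin.val_castSucc, Fin.val_succ]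
        split_ifs <;> simp only [Fin.val_castSucc, Fin.val_succ] <;> omega
      · rw [Fin.succAbove_succ_self, hα0, hb]
        exact Nat.lt_succ_self _

theorem IsAlternating.exists_dotProduct_eq {n m : ℕ} {X : Fin n → Fin m → ℝ}
    (hX : IsAlternating X) {T : Finset (Fin n)} (hT : T.card = m) (c : Fin n → ℝ) :
    ∃ w : Fin m → ℝ, ∀ i ∈ T, X i ⬝ᵥ w = c i := by
  have hdet := hX _ (T.orderEmbOfFin hT).strictMono
  set M := Matrix.of fun j => X (T.orderEmbOfFin hT j) with hM
  refine ⟨M⁻¹.mulVec fun j => c (T.orderEmbOfFin hT j), fun i hi => ?_⟩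
  obtain ⟨j, rfl⟩ : i ∈ Set.range (T.orderEmbOfFin hT) := by simpa using hi
  have h : M.mulVec (M⁻¹.mulVec fun j => c (T.orderEmbOfFin hT j)) =
      fun j => c (T.orderEmbOfFin hT j) := by
    rw [Matrix.mulVec_mulVec, Matrix.mul_nonsing_inv _ (isUnit_iff_ne_zero.2 hdet.ne'),
      Matrix.one_mulVec]
  exact congrFun h j

theorem IsAlternating.eq_zero_of_dotProduct {n m : ℕ} {X : Fin n → Fin m → ℝ}
    (hX : IsAlternating X) {T : Finset (Fin n)} (hT : m ≤ T.card) {w : Fin m → ℝ}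
    (hw : ∀ i ∈ T, X i ⬝ᵥ w = 0) : w = 0 := by
  obtain ⟨U, hUT, hU⟩ := Finset.exists_subset_card_eq hT
  have hdet := hX _ (U.orderEmbOfFin hU).strictMono
  refine Matrix.eq_zero_of_mulVec_eq_zero hdet.ne' (funext fun j => ?_)
  exact hw _ (hUT (U.orderEmbOfFin_mem hU j))

/-- A proper face is contained in a facet. -/
theorem IsAlternating.exists_facet {n d : ℕ} (hn : d + 1 ≤ n) {X : Fin n → Fin (d + 1) → ℝ}
    (hX : IsAlternating X) {S : Finset (Fin n)} (hS : IsFaceSet X S) (hne : S ≠ Finset.univ) :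
    ∃ Z, S ⊆ Z ∧ Z.card = d ∧ IsFaceSet X Z := by
  classical
  let C : Finset (Finset (Fin n)) :=
    Finset.univ.filter fun Z => S ⊆ Z ∧ Z ≠ Finset.univ ∧ IsFaceSet X Z
  obtain ⟨Z, hZ, hmax⟩ := Finset.exists_max_image C Finset.card
    ⟨S, by simp [C, hne, hS]⟩
  obtain ⟨hSZ, hZne, f, hf⟩ : S ⊆ Z ∧ Z ≠ Finset.univ ∧ IsFaceSet X Z := by simpa [C] using hZ
  refine ⟨Z, hSZ, le_antisymm ?_ ?_, f, hf⟩
  · by_contra h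
    have hf0 := hX.eq_zero_of_dotProduct (not_le.1 h) fun i hi => (hf i).1 hi
    obtain ⟨i, hi⟩ : ∃ i, i ∉ Z := by
      by_contra h'
      push Not at h'
      exact hZne (Finset.eq_univ_iff_forall.2 h')
    have := (hf i).2 hi
    simp [hf0] at this
  · by_contra hlt
    obtain ⟨T, hZT, -, hT⟩ := Finset.exists_subsuperset_card_eq (Finset.subset_univ Z)
      (show Z.card ≤ d + 1 by omega) (by simpa using hn)
    obtain ⟨a, ha, b, hb, hab⟩ : ∃ a ∈ T \ Z, ∃ b ∈ T \ Z, a ≠ b := by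
      refine Finset.one_lt_card.1 ?_
      rw [Finset.card_sdiff_of_subset hZT]
      omega
    rw [Finset.mem_sdiff] at ha hb
    obtain ⟨g, hg⟩ := hX.exists_dotProduct_eq hT (Pi.single a 1)
    have hga : X a ⬝ᵥ g = 1 := by rw [hg a ha.1, Pi.single_eq_same]
    have hgne : ∀ i ∈ T, i ≠ a → X i ⬝ᵥ g = 0 := fun i hi h => by
      rw [hg i hi, Pi.single_eq_of_ne h]
    obtain ⟨c, hc, hmin⟩ := Finset.exists_min_image
      (Finset.univ.filter fun i => 0 < X i ⬝ᵥ g) (fun i => X i ⬝ᵥ f / X i ⬝ᵥ g)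
      ⟨a, by simp [hga]⟩
    replace hc : 0 < X c ⬝ᵥ g := by simpa using hc
    have hnonneg : ∀ i, 0 ≤ X i ⬝ᵥ f := fun i => by
      by_cases hi : i ∈ Z
      · exact ((hf i).1 hi).ge
      · exact ((hf i).2 hi).le
    set s := X c ⬝ᵥ f / X c ⬝ᵥ g
    have hs : 0 ≤ s := div_nonneg (hnonneg c) hc.le
    have hval : ∀ i, X i ⬝ᵥ (f - s • g) = X i ⬝ᵥ f - s * X i ⬝ᵥ g := fun i => by
      rw [dotProduct_sub, dotProduct_smul, smul_eq_mul]
    have hpos : ∀ i, 0 ≤ X i ⬝ᵥ (f - s • g) := fun i => by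
      rw [hval]
      rcases lt_or_ge 0 (X i ⬝ᵥ g) with hi | hi
      · have := hmin i (by simpa using hi)
        rw [le_div_iff₀ hi] at this
        linarith
      · have := mul_nonpos_of_nonneg_of_nonpos hs hi
        linarith [hnonneg i]
    have hZ0 : ∀ i ∈ Z, X i ⬝ᵥ (f - s • g) = 0 := fun i hi => by
      rw [hval, (hf i).1 hi, hgne i (hZT hi) (fun h => ha.2 (h ▸ hi))]
      simp
    have hc0 : X c ⬝ᵥ (f - s • g) = 0 := by
      rw [hval, div_mul_cancel₀ _ hc.ne', sub_self]
    have hcZ : c ∉ Z := fun h => by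
      rw [hgne c (hZT h) (fun h' => ha.2 (h' ▸ h))] at hc
      exact lt_irrefl _ hc
    have hb0 : 0 < X b ⬝ᵥ (f - s • g) := by
      rw [hval, hgne b hb.1 hab.symm, mul_zero, sub_zero]
      exact (hf b).2 hb.2
    let Z' := Finset.univ.filter fun i => X i ⬝ᵥ (f - s • g) = 0
    have hsub : insert c Z ⊆ Z' := by
      intro i hi
      rcases Finset.mem_insert.1 hi with rfl | hi
      · simpa [Z'] using hc0
      · simpa [Z'] using hZ0 i hi
    have hZ' : Z' ∈ C := by
      simp only [C, Finset.mem_filter, Finset.mem_univ, true_and]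
      refine ⟨hSZ.trans ((Finset.subset_insert _ _).trans hsub), fun h => ?_, f - s • g,
        fun i => ⟨fun hi => by simpa [Z'] using hi, fun hi => ?_⟩⟩
      · have : b ∈ Z' := h ▸ Finset.mem_univ b
        exact hb0.ne' (by simpa [Z'] using this)
      · exact lt_of_le_of_ne (hpos i) (Ne.symm (by simpa [Z'] using hi))
    have h1 := hmax Z' hZ'
    have h2 := Finset.card_le_card hsub
    rw [Finset.card_insert_of_notMem hcZ] at h2
    omega

/-- Facets are determined by the chirotope. -/
theorem IsFaceSet.facet_transfer {n d : ℕ} (hn : d + 1 ≤ n) {X Y : Fin n → Fin (d + 1) → ℝ}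
    (hX : IsAlternating X) (hY : IsAlternating Y) {Z : Finset (Fin n)} (hZ : IsFaceSet X Z)
    (hcard : Z.card = d) : IsFaceSet Y Z := by
  classical
  obtain ⟨f, hf⟩ := hZ
  let u := Z.orderEmbOfFin hcard
  have hu : ∀ i ∉ Z, ∀ j, u j ≠ i := fun i hi j h => hi (h ▸ Z.orderEmbOfFin_mem hcard j)
  have hself : ∀ W : Fin n → Fin (d + 1) → ℝ, ∀ i ∈ Z,
      W i ⬝ᵥ normalVec (fun j => W (u j)) = 0 := fun W i hi => by
    obtain ⟨j, rfl⟩ : i ∈ Set.range u := by simpa [u] using hi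
    exact dotProduct_normalVec_self (fun j => W (u j)) j
  have hsame : ∀ i ∉ Z, 0 < (X i ⬝ᵥ normalVec fun j => X (u j)) *
      (Y i ⬝ᵥ normalVec fun j => Y (u j)) := fun i hi => by
    have h := mul_pos (hX.exists_dotProduct_normalVec_pos u.strictMono i (hu i hi))
      (hY.exists_dotProduct_normalVec_pos u.strictMono i (hu i hi))
    rwa [mul_mul_mul_comm, ← mul_pow, neg_one_mul, neg_neg, one_pow, one_mul] at h
  obtain ⟨a, ha⟩ : ∃ a, a ∉ Z := by
    by_contra h
    push Not at h
    have := Finset.card_le_card (fun i (_ : i ∈ Finset.univ) => h i)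
    rw [Finset.card_univ, Fintype.card_fin] at this
    omega
  set N := normalVec fun j => X (u j)
  set κ := X a ⬝ᵥ f / X a ⬝ᵥ N
  have hNa : X a ⬝ᵥ N ≠ 0 := left_ne_zero_of_mul (hsame a ha).ne'
  have hfN : f - κ • N = 0 := by
    refine hX.eq_zero_of_dotProduct (T := insert a Z)
      (by rw [Finset.card_insert_of_notMem ha, hcard]) fun i hi => ?_
    rw [dotProduct_sub, dotProduct_smul, smul_eq_mul]
    rcases Finset.mem_insert.1 hi with rfl | hi
    · rw [div_mul_cancel₀ _ hNa, sub_self]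
    · rw [hself X i hi, (hf i).1 hi, mul_zero, sub_zero]
  have hfi : ∀ i, X i ⬝ᵥ f = κ * X i ⬝ᵥ N := fun i => by
    conv_lhs => rw [sub_eq_zero.1 hfN]
    rw [dotProduct_smul, smul_eq_mul]
  refine ⟨κ • normalVec fun j => Y (u j), fun i => ⟨fun hi => ?_, fun hi => ?_⟩⟩
  · rw [dotProduct_smul, hself Y i hi, smul_zero]
  · rw [dotProduct_smul, smul_eq_mul]
    have h1 := (hf i).2 hi
    rw [hfi] at h1
    have h2 := mul_pos h1 (hsame i hi)
    have h3 : 0 < (X i ⬝ᵥ N) ^ 2 := by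
      have := left_ne_zero_of_mul (hsame i hi).ne'
      positivity
    refine pos_of_mul_pos_left (b := (X i ⬝ᵥ N) ^ 2) ?_ h3.le
    linarith

/-- Subsets of facets are faces. -/
theorem IsFaceSet.of_subset {n d : ℕ} (hn : d + 1 ≤ n) {X : Fin n → Fin (d + 1) → ℝ}
    (hX : IsAlternating X) {S Z : Finset (Fin n)} (hZ : IsFaceSet X Z)
    (hcard : Z.card = d) (hSZ : S ⊆ Z) : IsFaceSet X S := by
  classical
  obtain ⟨f, hf⟩ := hZ
  obtain ⟨T, hZT, -, hT⟩ := Finset.exists_subsuperset_card_eq (Finset.subset_univ Z)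
    (show Z.card ≤ d + 1 by omega) (by simpa using hn)
  obtain ⟨g, hg⟩ := hX.exists_dotProduct_eq hT (fun i => if i ∈ S then 0 else 1)
  have hev : ∀ᶠ ε : ℝ in nhdsWithin 0 (Set.Ioi 0),
      ∀ i, i ∉ Z → 0 < X i ⬝ᵥ f + ε * X i ⬝ᵥ g := by
    refine Filter.eventually_all.2 fun i => ?_
    by_cases hi : i ∈ Z
    · exact Filter.Eventually.of_forall fun _ h => absurd hi h
    · have hcont : Continuous fun ε : ℝ => X i ⬝ᵥ f + ε * X i ⬝ᵥ g := by fun_prop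
      have := (hcont.tendsto 0).eventually (lt_mem_nhds (a := 0) (by simpa using (hf i).2 hi))
      exact (this.filter_mono nhdsWithin_le_nhds).mono fun _ h _ => h
  obtain ⟨ε, hε, hε0⟩ := (hev.and self_mem_nhdsWithin).exists
  have hval : ∀ i, X i ⬝ᵥ (f + ε • g) = X i ⬝ᵥ f + ε * X i ⬝ᵥ g := fun i => by
    rw [dotProduct_add, dotProduct_smul, smul_eq_mul]
  refine ⟨f + ε • g, fun i => ⟨fun hi => ?_, fun hi => ?_⟩⟩
  · rw [hval, (hf i).1 (hSZ hi), hg i (hZT (hSZ hi)), if_pos hi]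
    simp
  · rw [hval]
    by_cases hiZ : i ∈ Z
    · rw [(hf i).1 hiZ, hg i (hZT hiZ), if_neg hi]
      simpa using hε0
    · exact hε i hiZ

theorem IsFaceSet.transfer {n d : ℕ} (hn : d + 1 ≤ n) {X Y : Fin n → Fin (d + 1) → ℝ}
    (hX : IsAlternating X) (hY : IsAlternating Y) {S : Finset (Fin n)} (hS : IsFaceSet X S) :
    IsFaceSet Y S := by
  by_cases hne : S = Finset.univ
  · exact ⟨0, fun i => ⟨fun _ => dotProduct_zero _, fun h => absurd (hne ▸ Finset.mem_univ i) h⟩⟩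
  · obtain ⟨Z, hSZ, hcard, hZ⟩ := hX.exists_facet hn hS hne
    exact (hZ.facet_transfer hn hX hY hcard).of_subset hn hY hcard hSZ

theorem homogenize_dotProduct {n d : ℕ} (x : Fin n → Fin d → ℝ) (i : Fin n)
    (w : Fin (d + 1) → ℝ) : homogenize x i ⬝ᵥ w = w 0 + ∑ j, x i j * w j.succ := by
  simp [homogenize, dotProduct, Fin.sum_univ_succ]

theorem exists_isExposed_of_isFaceSet {n d : ℕ} {x : Fin n → Fin d → ℝ} {S : Finset (Fin n)}
    (hS : IsFaceSet (homogenize x) S) (hne : S.Nonempty) :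
    ∃ F, IsExposed ℝ (convexHull ℝ (Set.range x)) F ∧ ∀ i, x i ∈ F ↔ i ∈ S := by
  obtain ⟨w, hw⟩ := hS
  let l : StrongDual ℝ (Fin d → ℝ) :=
    LinearMap.toContinuousLinearMap (∑ j, (-w j.succ) • LinearMap.proj j)
  have hl : ∀ i, l (x i) = w 0 - homogenize x i ⬝ᵥ w := fun i => by
    simp [l, homogenize_dotProduct, mul_comm]
  have hnonneg : ∀ i, 0 ≤ homogenize x i ⬝ᵥ w := fun i => by
    by_cases hi : i ∈ S
    · exact ((hw i).1 hi).ge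
    · exact ((hw i).2 hi).le
  have hle : ∀ y ∈ convexHull ℝ (Set.range x), l y ≤ w 0 := by
    have : convexHull ℝ (Set.range x) ⊆ {y | l y ≤ w 0} := by
      refine convexHull_min ?_ (convex_halfSpace_le l.toLinearMap.isLinear _)
      rintro _ ⟨i, rfl⟩
      change l (x i) ≤ w 0
      rw [hl]
      linarith [hnonneg i]
    exact this
  obtain ⟨a, ha⟩ := hne
  have hla : l (x a) = w 0 := by rw [hl, (hw a).1 ha, sub_zero]
  have hmem : ∀ i, x i ∈ convexHull ℝ (Set.range x) := fun i =>
    subset_convexHull ℝ _ (Set.mem_range_self i)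
  refine ⟨{y ∈ convexHull ℝ (Set.range x) | ∀ z ∈ convexHull ℝ (Set.range x), l z ≤ l y},
    fun _ => ⟨l, rfl⟩, fun i => ⟨fun hi => ?_, fun hi => ⟨hmem i, fun z hz => ?_⟩⟩⟩
  · by_contra h
    have h1 := hi.2 _ (hmem a)
    rw [hla, hl] at h1
    linarith [(hw i).2 h]
  · rw [hl i, (hw i).1 hi, sub_zero]
    exact hle z hz

theorem IsExposed.extremePoints_eq_image {n d : ℕ} {x : Fin n → Fin d → ℝ}
    (hext : ∀ i, x i ∈ Set.extremePoints ℝ (convexHull ℝ (Set.range x))) {F : Set (Fin d → ℝ)}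
    (hF : IsExposed ℝ (convexHull ℝ (Set.range x)) F) :
    Set.extremePoints ℝ F = x '' {i | x i ∈ F} := by
  rw [hF.isExtreme.extremePoints_eq]
  ext y
  constructor
  · rintro ⟨hy, hy'⟩
    obtain ⟨i, rfl⟩ := extremePoints_convexHull_subset hy'
    exact ⟨i, hy, rfl⟩
  · rintro ⟨i, hi, rfl⟩
    exact ⟨hi, hext i⟩

theorem isVertexSetOfFace_of_isFaceSet {n d : ℕ} {x : Fin n → Fin d → ℝ}
    (hext : ∀ i, x i ∈ Set.extremePoints ℝ (convexHull ℝ (Set.range x))) {S : Finset (Fin n)}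
    (hS : IsFaceSet (homogenize x) S) : IsVertexSetOfFace x S := by
  rcases S.eq_empty_or_nonempty with rfl | hne
  · exact ⟨∅, Or.inr fun h => absurd h Set.not_nonempty_empty, by simp⟩
  · obtain ⟨F, hF, hiff⟩ := exists_isExposed_of_isFaceSet hS hne
    refine ⟨F, Or.inr hF, ?_⟩
    rw [hF.extremePoints_eq_image hext]
    congr 1
    ext i
    simp [hiff]

theorem isVertexSetOfFace_iff {n d : ℕ} {x : Fin n → Fin d → ℝ} (hinj : Function.Injective x)
    (hext : ∀ i, x i ∈ Set.extremePoints ℝ (convexHull ℝ (Set.range x))) {S : Finset (Fin n)} :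
    IsVertexSetOfFace x S ↔ IsFaceSet (homogenize x) S := by
  refine ⟨?_, isVertexSetOfFace_of_isFaceSet hext⟩
  have hmem : ∀ i, x i ∈ convexHull ℝ (Set.range x) := fun i =>
    subset_convexHull ℝ _ (Set.mem_range_self i)
  rintro ⟨F, rfl | hF, hFS⟩
  · refine ⟨0, fun i => ⟨fun _ => dotProduct_zero _, fun hi => absurd ?_ hi⟩⟩
    have h := hext i
    rw [hFS] at h
    obtain ⟨j, hj, hji⟩ := h
    rwa [← hinj hji]
  · rw [hF.extremePoints_eq_image hext] at hFS
    have hiff : ∀ i, x i ∈ F ↔ i ∈ S := fun i => by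
      have := congrArg (i ∈ ·) (hinj.image_injective hFS)
      simpa using this
    rcases F.eq_empty_or_nonempty with rfl | hne
    · refine ⟨Pi.single 0 1, fun i => ⟨fun hi => absurd ((hiff i).2 hi) (Set.notMem_empty _),
        fun _ => ?_⟩⟩
      simp [homogenize]
    · obtain ⟨l, rfl⟩ := hF hne
      obtain ⟨z, hz, hzmax⟩ := hne
      have hlsum : ∀ y : Fin d → ℝ, l y = ∑ j, y j * l (Pi.single j 1) := fun y => by
        conv_lhs => rw [pi_eq_sum_univ' y]
        simp [map_sum]
      have hval : ∀ i, homogenize x i ⬝ᵥ (Fin.cons (l z) fun j => -l (Pi.single j 1)) =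
          l z - l (x i) := fun i => by
        rw [homogenize_dotProduct, hlsum (x i)]
        simp [sub_eq_add_neg]
      refine ⟨Fin.cons (l z) fun j => -l (Pi.single j 1), fun i => ⟨fun hi => ?_, fun hi => ?_⟩⟩
      · rw [hval, sub_eq_zero]
        exact le_antisymm (((hiff i).2 hi).2 z hz) (hzmax _ (hmem i))
      · rw [hval, sub_pos]
        refine lt_of_le_of_ne (hzmax _ (hmem i)) fun h => hi ((hiff i).1 ⟨hmem i, fun y hy => ?_⟩)
        rw [h]
        exact hzmax y hy

theorem injective_of_isFaceSet_singleton {n d : ℕ} {x : Fin n → Fin d → ℝ}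
    (h : ∀ i, IsFaceSet (homogenize x) {i}) : Function.Injective x := by
  intro i j hij
  by_contra hne
  obtain ⟨w, hw⟩ := h i
  have h1 := (hw i).1 (by simp)
  have h2 := (hw j).2 (by simpa using Ne.symm hne)
  have h3 : homogenize x i = homogenize x j := by simp only [homogenize, hij]
  rw [← h3] at h2
  exact h2.ne' h1

theorem mem_extremePoints_of_isFaceSet_singleton {n d : ℕ} {x : Fin n → Fin d → ℝ}
    (h : ∀ i, IsFaceSet (homogenize x) {i}) (i : Fin n) :
    x i ∈ Set.extremePoints ℝ (convexHull ℝ (Set.range x)) := by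
  obtain ⟨F, hF, hiff⟩ := exists_isExposed_of_isFaceSet (h i) (Finset.singleton_nonempty i)
  have hcomp : IsCompact F := hF.isCompact ((Set.finite_range x).isCompact_convexHull ℝ)
  obtain ⟨y, hy⟩ := hcomp.extremePoints_nonempty ⟨x i, (hiff i).2 (by simp)⟩
  rw [hF.isExtreme.extremePoints_eq] at hy
  obtain ⟨j, rfl⟩ := extremePoints_convexHull_subset hy.2
  have hj : j = i := by simpa using (hiff j).1 hy.1
  exact hj ▸ hy.2

/-- The vertices of a cyclic polytope on the moment curve. -/
def momentPoints {n : ℕ} (d : ℕ) (t : Fin n → ℝ) : Fin n → Fin d → ℝ :=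
  fun i j => t i ^ ((j : ℕ) + 1)

theorem homogenize_momentPoints {n d : ℕ} (t : Fin n → ℝ) (i : Fin n) (j : Fin (d + 1)) :
    homogenize (momentPoints d t) i j = t i ^ (j : ℕ) := by
  refine Fin.cases ?_ (fun j => ?_) j <;> simp [homogenize, momentPoints]

theorem isAlternating_momentPoints {n d : ℕ} {t : Fin n → ℝ} (ht : StrictMono t) :
    IsAlternating (homogenize (momentPoints d t)) := by
  intro σ hσ
  have h : (Matrix.of fun j => homogenize (momentPoints d t) (σ j)) =
      Matrix.vandermonde (fun j => t (σ j)) := by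
    ext i j
    rw [Matrix.of_apply, homogenize_momentPoints, Matrix.vandermonde_apply]
  rw [h, Matrix.det_vandermonde]
  exact Finset.prod_pos fun i _ => Finset.prod_pos fun j hj =>
    sub_pos.2 (ht (hσ (Finset.mem_Ioi.1 hj)))

open Polynomial in
theorem isFaceSet_momentPoints {n d : ℕ} {t : Fin n → ℝ} {S : Finset (Fin n)} (q : ℝ[X])
    (hdeg : q.natDegree ≤ d) (h0 : ∀ i ∈ S, q.eval (t i) = 0)
    (hpos : ∀ i ∉ S, 0 < q.eval (t i)) : IsFaceSet (homogenize (momentPoints d t)) S := by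
  have h : ∀ i, homogenize (momentPoints d t) i ⬝ᵥ (fun j => q.coeff j) = q.eval (t i) := by
    intro i
    rw [eval_eq_sum_range' (Nat.lt_succ_of_le hdeg), Finset.sum_range, dotProduct]
    exact Finset.sum_congr rfl fun j _ => by rw [homogenize_momentPoints, mul_comm]
  exact ⟨fun j => q.coeff j, fun i =>
    ⟨fun hi => (h i).trans (h0 i hi), fun hi => (hpos i hi).trans_eq (h i).symm⟩⟩

open Polynomial in
theorem hasCyclicFaces_momentPoints {n k : ℕ} {t : Fin n → ℝ} (ht : StrictMono t) :
    HasCyclicFaces k (homogenize (momentPoints (k + k) t)) := by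
  have hdeg : ∀ P : Finset (Fin n),
      (∏ s ∈ P, (X - C (t s)) ^ 2 : ℝ[X]).natDegree ≤ P.card + P.card := fun P => by
    refine (natDegree_prod_le _ _).trans ?_
    refine (Finset.sum_le_card_nsmul _ _ 2 fun s _ => ?_).trans (by rw [smul_eq_mul]; omega)
    exact natDegree_pow_le.trans (by rw [natDegree_X_sub_C])
  have hpos : ∀ P : Finset (Fin n), ∀ i ∉ P,
      0 < (∏ s ∈ P, (X - C (t s)) ^ 2 : ℝ[X]).eval (t i) := fun P i hi => by
    rw [eval_prod]
    refine Finset.prod_pos fun s hs => ?_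
    have : t i - t s ≠ 0 := sub_ne_zero.2 fun h => hi (ht.injective h ▸ hs)
    simp only [eval_pow, eval_sub, eval_X, eval_C]
    positivity
  have hzero : ∀ P : Finset (Fin n), ∀ i ∈ P,
      (∏ s ∈ P, (X - C (t s)) ^ 2 : ℝ[X]).eval (t i) = 0 := fun P i hi => by
    rw [eval_prod]
    exact Finset.prod_eq_zero hi (by simp)
  rintro P (hP | ⟨hP, a, ha, b, hb, hab⟩)
  · exact isFaceSet_momentPoints _ ((hdeg P).trans (by omega)) (hzero P) (hpos P)
  · set Q := (P.erase a).erase b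
    have hba : b ≠ a := fun h => by rw [h] at hab; omega
    have hQ : Q.card + 2 = P.card := by
      have h1 := Finset.card_erase_add_one ha
      have h2 : Q.card + 1 = _ := Finset.card_erase_add_one (Finset.mem_erase.2 ⟨hba, hb⟩)
      omega
    refine isFaceSet_momentPoints
      ((X - C (t a)) * (X - C (t b)) * ∏ s ∈ Q, (X - C (t s)) ^ 2) ?_ (fun i hi => ?_)
      (fun i hi => ?_)
    · have h1 := natDegree_mul_le (p := (X - C (t a)) * (X - C (t b)))
        (q := ∏ s ∈ Q, (X - C (t s)) ^ 2)
      have h2 := natDegree_mul_le (p := X - C (t a)) (q := X - C (t b))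
      rw [natDegree_X_sub_C, natDegree_X_sub_C] at h2
      have := hdeg Q
      omega
    · by_cases h1 : i = a
      · simp [h1]
      by_cases h2 : i = b
      · simp [h2]
      · rw [eval_mul, hzero Q i (Finset.mem_erase.2 ⟨h2, Finset.mem_erase.2 ⟨h1, hi⟩⟩), mul_zero]
    · rw [eval_mul]
      refine mul_pos ?_ (hpos Q i fun h => hi (Finset.mem_of_mem_erase (Finset.mem_of_mem_erase h)))
      simp only [eval_mul, eval_sub, eval_X, eval_C]
      have hia : i ≠ a := fun h => hi (h ▸ ha)
      have hib : i ≠ b := fun h => hi (h ▸ hb)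
      rcases lt_or_gt_of_ne hia with h | h
      · have hbi : i < b := by rw [Fin.lt_def] at h ⊢; omega
        exact mul_pos_of_neg_of_neg (sub_neg.2 (ht h)) (sub_neg.2 (ht hbi))
      · have hbi : b < i := by
          have : (i : ℕ) ≠ b := fun h => hib (Fin.ext h)
          rw [Fin.lt_def] at h ⊢
          omega
        exact mul_pos (sub_pos.2 (ht h)) (sub_pos.2 (ht hbi))

/-- The realization space of an even-dimensional cyclic polytope consists of the configurations
with the same oriented matroid. -/
theorem mem_realizationSpace_momentPoints_iff {n k : ℕ} (hk : 1 ≤ k) (hn : k + k + 2 ≤ n)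
    {t : Fin n → ℝ} (ht : StrictMono t) {B : Finset (Fin n)}
    (hB : ∀ i : Fin n, i ∈ B ↔ (i : ℕ) < k + k + 1) (x : Fin n → Fin (k + k) → ℝ) :
    x ∈ polytopeRealizationSpace (momentPoints (k + k) t) B ↔
      (∀ i ∈ B, x i = momentPoints (k + k) t i) ∧ IsAlternating (homogenize x) := by
  set v := momentPoints (k + k) t
  have hv : IsAlternating (homogenize v) := isAlternating_momentPoints ht
  have hvf : HasCyclicFaces k (homogenize v) := hasCyclicFaces_momentPoints ht
  have hvs : ∀ i, IsFaceSet (homogenize v) {i} := fun i => hvf _ (Or.inl (by simpa using hk))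
  have hviff : ∀ S, IsVertexSetOfFace v S ↔ IsFaceSet (homogenize v) S := fun S =>
    isVertexSetOfFace_iff (injective_of_isFaceSet_singleton hvs)
      (mem_extremePoints_of_isFaceSet_singleton hvs)
  have hn' : k + k + 1 ≤ n := by omega
  constructor
  · rintro ⟨hx, hext, hfaces⟩
    refine ⟨hx, ?_⟩
    have hinj : Function.Injective x := by
      intro i j hij
      by_contra hne
      have hface : IsVertexSetOfFace x (Finset.univ.erase i) := by
        refine ⟨_, Or.inl rfl, subset_antisymm (fun y hy => ?_) ?_⟩
        · obtain ⟨a, rfl⟩ := extremePoints_convexHull_subset hy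
          by_cases ha : a = i
          · exact ⟨j, by simpa using Ne.symm hne, by rw [ha, hij]⟩
          · exact ⟨a, by simpa using ha, rfl⟩
        · rintro _ ⟨a, -, rfl⟩
          exact hext a
      obtain ⟨w, hw⟩ := (hviff _).1 ((hfaces _).1 hface)
      have hw0 : w = 0 := hv.eq_zero_of_dotProduct (T := Finset.univ.erase i)
        (by rw [Finset.card_erase_of_mem (Finset.mem_univ i), Finset.card_univ,
              Fintype.card_fin]; omega) fun a ha => (hw a).1 ha
      have := (hw i).2 (by simp)
      simp [hw0] at this
    have hxf : HasCyclicFaces k (homogenize x) := fun P hP =>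
      (isVertexSetOfFace_iff hinj hext).1 ((hfaces P).2 ((hviff P).2 (hvf P hP)))
    refine hxf.isAlternating (fun i => rfl) fun σ hσ => ?_
    have hmono : StrictMono σ := fun a b hab => by
      rw [Fin.lt_def, hσ, hσ]; exact hab
    have heq : ∀ j, homogenize x (σ j) = homogenize v (σ j) := fun j => by
      have hj : σ j ∈ B := (hB _).2 (by rw [hσ]; exact j.2)
      simp only [homogenize, hx _ hj]
    simpa only [heq] using hv σ hmono
  · rintro ⟨hx, halt⟩
    have hiff : ∀ S, IsFaceSet (homogenize x) S ↔ IsFaceSet (homogenize v) S := fun S =>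
      ⟨fun h => h.transfer hn' halt hv, fun h => h.transfer hn' hv halt⟩
    have hxs : ∀ i, IsFaceSet (homogenize x) {i} := fun i => (hiff _).2 (hvs i)
    have hext := mem_extremePoints_of_isFaceSet_singleton hxs
    refine ⟨hx, hext, fun S => ?_⟩
    rw [isVertexSetOfFace_iff (injective_of_isFaceSet_singleton hxs) hext, hviff, hiff]

theorem eventually_sum_pow_mul_pos {N : ℕ} (c : Fin N → ℝ) (r : Fin N)
    (h0 : ∀ l < r, c l = 0) (hr : 0 < c r) :
    ∀ᶠ ε : ℝ in nhdsWithin 0 (Set.Ioi 0), 0 < ∑ l : Fin N, ε ^ (l : ℕ) * c l := by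
  have hcont : Continuous fun ε : ℝ =>
      ∑ l : Fin N, if l < r then 0 else ε ^ ((l : ℕ) - r) * c l := by
    refine continuous_finsetSum _ fun l _ => ?_
    split_ifs <;> fun_prop
  have hval : (∑ l : Fin N, if l < r then 0 else (0 : ℝ) ^ ((l : ℕ) - r) * c l) = c r := by
    rw [Finset.sum_eq_single r]
    · simp
    · intro l _ hl
      split_ifs with h
      · rfl
      · have : r < l := lt_of_le_of_ne (not_lt.1 h) (Ne.symm hl)
        rw [zero_pow (Nat.sub_ne_zero_of_lt this), zero_mul]
    · simp
  have hev := (hcont.tendsto 0).eventually (lt_mem_nhds (a := 0) (by rw [hval]; exact hr))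
  filter_upwards [hev.filter_mono nhdsWithin_le_nhds, self_mem_nhdsWithin] with ε hε hε0
  have : ∑ l : Fin N, ε ^ (l : ℕ) * c l =
      ε ^ (r : ℕ) * ∑ l : Fin N, if l < r then 0 else ε ^ ((l : ℕ) - r) * c l := by
    rw [Finset.mul_sum]
    refine Finset.sum_congr rfl fun l _ => ?_
    split_ifs with h
    · rw [h0 l h, mul_zero, mul_zero]
    · rw [← mul_assoc, ← pow_add, Nat.add_sub_cancel' (not_lt.1 h)]
  rw [this]
  exact mul_pos (pow_pos hε0 _) hε

/-- An alternating configuration can be extended by one more point. -/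
theorem IsAlternating.exists_extension {d m : ℕ} (hd : Even d) (hm : d + 1 ≤ m)
    {X : Fin m → Fin (d + 1) → ℝ} (hX : IsAlternating X) (h1 : ∀ i, X i 0 = 1) :
    ∃ y : Fin d → ℝ, ∀ u : Fin d → Fin m, StrictMono u →
      0 < (Fin.cons 1 y : Fin (d + 1) → ℝ) ⬝ᵥ normalVec fun j => X (u j) := by
  let b : Fin (d + 1) → Fin m := fun l => ⟨m - 1 - l, by omega⟩
  have hb : ∀ l, (b l : ℕ) = m - 1 - l := fun l => rfl
  have hbinj : Function.Injective b := fun l l' h => by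
    have := congrArg Fin.val h
    rw [hb, hb] at this
    exact Fin.ext (by omega)
  have hminor : ∀ u : Fin d → Fin m, StrictMono u → ∀ᶠ ε : ℝ in nhdsWithin 0 (Set.Ioi 0),
      0 < ∑ l : Fin (d + 1), ε ^ (l : ℕ) *
        ((-1) ^ (l : ℕ) * (X (b l) ⬝ᵥ normalVec fun j => X (u j))) := by
    intro u hu
    have hex : ∃ a : ℕ, ∃ l : Fin (d + 1), (l : ℕ) = a ∧ ∀ j, u j ≠ b l := by
      by_contra h
      push Not at h
      have hsub : Finset.univ.image b ⊆ Finset.univ.image u := by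
        intro i hi
        obtain ⟨l, -, rfl⟩ := Finset.mem_image.1 hi
        obtain ⟨j, hj⟩ := h l l rfl
        exact Finset.mem_image.2 ⟨j, Finset.mem_univ j, hj⟩
      have := Finset.card_le_card hsub
      rw [Finset.card_image_of_injective _ hbinj, Finset.card_image_of_injective _ hu.injective,
        Finset.card_univ, Finset.card_univ, Fintype.card_fin, Fintype.card_fin] at this
      omega
    classical
    obtain ⟨r, hra, hr⟩ := Nat.find_spec hex
    have hmin : ∀ l < r, ∃ j, u j = b l := fun l hl => by
      by_contra h
      push Not at h
      have hl' : (l : ℕ) < r := hl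
      exact Nat.find_min hex (hra ▸ hl') ⟨l, rfl, h⟩
    refine eventually_sum_pow_mul_pos _ r (fun l hl => ?_) ?_
    · obtain ⟨j, hj⟩ := hmin l hl
      rw [← hj, dotProduct_normalVec_self (fun j => X (u j)) j, mul_zero]
    · have hpos := hX.exists_dotProduct_normalVec_pos hu (b r) hr
      have hgt : ((Finset.univ.filter fun j => ¬ u j < b r).image u) = Finset.Ioi (b r) := by
        ext i
        simp only [Finset.mem_image, Finset.mem_filter, Finset.mem_univ, true_and,
          Finset.mem_Ioi, not_lt]
        constructor
        · rintro ⟨j, hj, rfl⟩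
          exact lt_of_le_of_ne hj (hr j).symm
        · intro hi
          have hi' : (b r : ℕ) < i := hi
          have him := i.2
          rw [hb] at hi'
          obtain ⟨j, hj⟩ := hmin ⟨m - 1 - i, by omega⟩ (by rw [Fin.lt_def]; dsimp only; omega)
          have hji : u j = i := by
            rw [hj]; apply Fin.ext; rw [hb]; dsimp only; omega
          exact ⟨j, hji ▸ hi.le, hji⟩
      have hcard := congrArg Finset.card hgt
      rw [Finset.card_image_of_injective _ hu.injective, Fin.card_Ioi, hb] at hcard
      have hsum := Finset.card_filter_add_card_filter_not (s := Finset.univ) (fun j => u j < b r)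
      rw [Finset.card_univ, Fintype.card_fin] at hsum
      set p := (Finset.univ.filter fun j => u j < b r).card
      have hpr : p + r = d := by omega
      have hsign : (-1 : ℝ) ^ (r : ℕ) = (-1) ^ p := by
        have h : (-1 : ℝ) ^ p * (-1) ^ (r : ℕ) = 1 := by
          rw [← pow_add, hpr, hd.neg_one_pow]
        rcases neg_one_pow_eq_or ℝ p with hp | hp <;> rw [hp] at h ⊢ <;> linarith
      rw [hsign]
      exact hpos
  have hone : ∀ᶠ ε : ℝ in nhdsWithin 0 (Set.Ioi 0),
      0 < ∑ l : Fin (d + 1), ε ^ (l : ℕ) * (-1) ^ (l : ℕ) :=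
    eventually_sum_pow_mul_pos _ 0 (fun l hl => absurd hl (Fin.not_lt_zero l)) (by simp)
  obtain ⟨ε, hε, hε1⟩ := ((Filter.eventually_all.2 fun u : Fin d → Fin m =>
    Filter.eventually_imp_distrib_left.2 (hminor u)).and hone).exists
  let Y : Fin (d + 1) → ℝ := ∑ l : Fin (d + 1), (ε ^ (l : ℕ) * (-1) ^ (l : ℕ)) • X (b l)
  have hY0 : 0 < Y 0 := by
    simpa [Y, h1] using hε1
  have hcons : (Fin.cons 1 (fun j => (Y 0)⁻¹ * Y j.succ) : Fin (d + 1) → ℝ) = (Y 0)⁻¹ • Y := by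
    ext j
    refine Fin.cases ?_ (fun j => ?_) j
    · simp [hY0.ne']
    · simp
  refine ⟨fun j => (Y 0)⁻¹ * Y j.succ, fun u hu => ?_⟩
  rw [hcons, smul_dotProduct, smul_eq_mul]
  refine mul_pos (inv_pos.2 hY0) ?_
  have := hε u hu
  simpa [Y, sum_dotProduct, mul_assoc] using this

theorem contractibleSpace_of_convex_fibers {n : ℕ} {E : Type*} [NormedAddCommGroup E]
    [NormedSpace ℝ E] {R R' : Set (Fin n → E)} (a : Fin n) (e : E) (hR : ∀ x ∈ R, x a = e)
    (hproj : ∀ x ∈ R', Function.update x a e ∈ R)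
    (hconv : ∀ x ∈ R, Convex ℝ {y | Function.update x a y ∈ R'})
    (hlocal : ∀ x ∈ R, ∃ y, ∀ᶠ z in nhds x, z ∈ R → Function.update z a y ∈ R')
    [ContractibleSpace R] : ContractibleSpace R' := by
  obtain ⟨s, hs⟩ := exists_continuous_forall_mem_convex_of_local_const
    (t := fun x : R => {y | Function.update (x : Fin n → E) a y ∈ R'})
    (fun x => hconv x x.2) fun x => by
      obtain ⟨y, hy⟩ := hlocal x x.2
      exact ⟨y, (continuous_subtype_val.tendsto x |>.eventually hy).mono fun z hz => hz z.2⟩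
  let p : C(R', R) := ⟨fun x => ⟨Function.update x a e, hproj x x.2⟩, by fun_prop⟩
  let q : C(R, R') := ⟨fun x => ⟨Function.update x a (s x), hs x⟩, by fun_prop⟩
  have hmem : ∀ (θ : unitInterval) (x : R'), Function.update (x : Fin n → E) a
      ((1 - (θ : ℝ)) • s (p x) + (θ : ℝ) • (x : Fin n → E) a) ∈ R' := fun θ x => by
    have hx : (x : Fin n → E) a ∈ {y | Function.update (p x : Fin n → E) a y ∈ R'} := by
      simp [p]
    have := hconv _ (p x).2 (hs (p x)) hx (sub_nonneg.2 θ.2.2) θ.2.1 (by ring)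
    simpa [p] using this
  let H : ContinuousMap.Homotopy (q.comp p) (ContinuousMap.id R') :=
    { toFun := fun z => ⟨_, hmem z.1 z.2⟩
      continuous_toFun := by
        have hsp : Continuous fun z : unitInterval × R' => s (p z.2) :=
          s.continuous.comp (p.continuous.comp continuous_snd)
        have hθ : Continuous fun z : unitInterval × R' => (z.1 : ℝ) :=
          continuous_subtype_val.comp continuous_fst
        have hx : Continuous fun z : unitInterval × R' => (z.2 : Fin n → E) :=
          continuous_subtype_val.comp continuous_snd
        exact (hx.update a (((continuous_const.sub hθ).smul hsp).add
          (hθ.smul ((continuous_apply a).comp hx)))).subtype_mk _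
      map_zero_left := fun x => by
        ext1
        simp [p, q]
      map_one_left := fun x => by
        ext1
        simp }
  have hpq : p.comp q = ContinuousMap.id R := by
    ext1 x
    apply Subtype.ext
    simp [p, q, ← hR x x.2]
  let e' : ContinuousMap.HomotopyEquiv R' R :=
    { toFun := p
      invFun := q
      left_inv := ⟨H⟩
      right_inv := by rw [hpq] }
  exact e'.contractibleSpace

/-- Configurations whose first `m` points are alternating, with the first `d + 1` points and the
points from the `m`-th one onwards fixed. -/
def stageSpace {n d : ℕ} (v : Fin n → Fin d → ℝ) (m : ℕ) : Set (Fin n → Fin d → ℝ) :=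
  {x | (∀ i : Fin n, (i : ℕ) < d + 1 ∨ m ≤ i → x i = v i) ∧
    ∀ σ : Fin (d + 1) → Fin n, StrictMono σ → (∀ j, (σ j : ℕ) < m) →
      0 < (Matrix.of fun j => homogenize x (σ j)).det}

theorem continuous_det_homogenize {n d : ℕ} {T : Type*} [TopologicalSpace T]
    {f : T → Fin n → Fin d → ℝ} (hf : Continuous f) (σ : Fin (d + 1) → Fin n) :
    Continuous fun z => (Matrix.of fun j => homogenize (f z) (σ j)).det := by
  refine Continuous.matrix_det (continuous_matrix fun i j => ?_)
  refine Fin.cases ?_ (fun j => ?_) j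
  · simpa [homogenize] using continuous_const
  · simp only [homogenize, Matrix.of_apply, Fin.cons_succ]
    fun_prop

theorem update_mem_stageSpace_iff {n d m : ℕ} (hd : Even d) (hm : d + 1 ≤ m) (hmn : m < n)
    {v x : Fin n → Fin d → ℝ} (hx : x ∈ stageSpace v m) (y : Fin d → ℝ) :
    Function.update x ⟨m, hmn⟩ y ∈ stageSpace v (m + 1) ↔
      ∀ u : Fin d → Fin n, StrictMono u → (∀ j, (u j : ℕ) < m) →
        0 < (Fin.cons 1 y : Fin (d + 1) → ℝ) ⬝ᵥ normalVec fun j => homogenize x (u j) := by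
  set a : Fin n := ⟨m, hmn⟩
  have hlt : ∀ i : Fin n, (i : ℕ) < m → homogenize (Function.update x a y) i = homogenize x i := by
    intro i hi
    have : i ≠ a := fun h => by simp [h, a] at hi
    simp only [homogenize, Function.update_of_ne this]
  have ha : homogenize (Function.update x a y) a = Fin.cons 1 y := by
    simp [homogenize]
  have hdet : ∀ u : Fin d → Fin n, (∀ j, (u j : ℕ) < m) →
      (Matrix.of fun j => homogenize (Function.update x a y)
        (((Fin.last d).insertNth a u : Fin (d + 1) → Fin n) j)).det =
      (Fin.cons 1 y : Fin (d + 1) → ℝ) ⬝ᵥ normalVec fun j => homogenize x (u j) := by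
    intro u hu
    have h : (Matrix.of fun j => homogenize (Function.update x a y)
        (((Fin.last d).insertNth a u : Fin (d + 1) → Fin n) j)) = Matrix.of ((Fin.last d).insertNth
          (Fin.cons 1 y : Fin (d + 1) → ℝ) fun j => homogenize x (u j)) := by
      ext i k
      rcases Fin.eq_self_or_eq_succAbove (Fin.last d) i with rfl | ⟨i, rfl⟩
      · simp only [Matrix.of_apply, Fin.insertNth_apply_same, ha]
      · simp only [Matrix.of_apply, Fin.insertNth_apply_succAbove, hlt _ (hu i)]
    rw [h, det_insertNth, Fin.val_last, hd.neg_one_pow, one_mul]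
  constructor
  · rintro ⟨-, h⟩ u hu hum
    rw [← hdet u hum]
    refine h _ (strictMono_insertNth hu a _ (fun j _ => hum j) fun j hj => ?_) fun j => ?_
    · exact absurd hj (not_le.2 (Fin.castSucc_lt_last j))
    · rcases Fin.eq_self_or_eq_succAbove (Fin.last d) j with rfl | ⟨j, rfl⟩
      · simp [a]
      · simpa only [Fin.insertNth_apply_succAbove] using (hum j).trans (Nat.lt_succ_self m)
  · intro h
    refine ⟨fun i hi => ?_, fun σ hσ hσm => ?_⟩
    · have hne : i ≠ a := fun h => by
        have : (i : ℕ) = m := congrArg Fin.val h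
        omega
      rw [Function.update_of_ne hne]
      exact hx.1 i (by omega)
    · have hlast : ∀ j : Fin d, (σ j.castSucc : ℕ) < m := fun j => by
        have h1 : (σ j.castSucc : ℕ) < σ (Fin.last d) := hσ (Fin.castSucc_lt_last j)
        have h2 := hσm (Fin.last d)
        omega
      by_cases hcase : σ (Fin.last d) = a
      · have hσeq : σ =
            ((Fin.last d).insertNth a fun j => σ j.castSucc : Fin (d + 1) → Fin n) := by
          ext i
          rcases Fin.eq_self_or_eq_succAbove (Fin.last d) i with rfl | ⟨i, rfl⟩
          · rw [hcase, Fin.insertNth_apply_same]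
          · rw [Fin.insertNth_apply_succAbove, Fin.succAbove_last]
        rw [hσeq, hdet _ hlast]
        exact h _ (hσ.comp Fin.strictMono_castSucc) hlast
      · have hm' : ∀ j, (σ j : ℕ) < m := fun j => by
          refine Fin.lastCases ?_ hlast j
          exact lt_of_le_of_ne (Nat.le_of_lt_succ (hσm _)) fun h => hcase (Fin.ext h)
        simp only [hlt _ (hm' _)]
        exact hx.2 σ hσ hm'

theorem contractibleSpace_stageSpace_succ {n d m : ℕ} (hd : Even d) (hm : d + 1 ≤ m) (hmn : m < n)
    (v : Fin n → Fin d → ℝ) [ContractibleSpace (stageSpace v m)] :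
    ContractibleSpace (stageSpace v (m + 1)) := by
  have hiff := fun (x : Fin n → Fin d → ℝ) (hx : x ∈ stageSpace v m) (y : Fin d → ℝ) =>
    update_mem_stageSpace_iff hd hm hmn hx y
  refine contractibleSpace_of_convex_fibers (R := stageSpace v m) ⟨m, hmn⟩ (v ⟨m, hmn⟩)
    (fun x hx => hx.1 _ (Or.inr le_rfl)) (fun x hx => ⟨fun i hi => ?_, fun σ hσ hσm => ?_⟩)
    (fun x hx => ?_) fun x hx => ?_
  · by_cases h : i = ⟨m, hmn⟩
    · rw [h, Function.update_self]
    · rw [Function.update_of_ne h]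
      have : (i : ℕ) ≠ m := fun h' => h (Fin.ext h')
      exact hx.1 i (by omega)
  · have heq : ∀ j, homogenize (Function.update x ⟨m, hmn⟩ (v ⟨m, hmn⟩)) (σ j) =
        homogenize x (σ j) := fun j => by
      have : σ j ≠ ⟨m, hmn⟩ := fun h => by
        have := hσm j
        simp [h] at this
      simp only [homogenize, Function.update_of_ne this]
    simp only [heq]
    exact hx.2 σ hσ fun j => (hσm j).trans (Nat.lt_succ_self m)
  · simp only [hiff x hx]
    intro y hy z hz s r hs hr hsr u hu hum
    have hcomb : (Fin.cons 1 (s • y + r • z) : Fin (d + 1) → ℝ) =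
        s • Fin.cons 1 y + r • Fin.cons 1 z := by
      ext j
      refine Fin.cases ?_ (fun j => ?_) j
      · simp [hsr]
      · simp
    rw [hcomb, add_dotProduct, smul_dotProduct, smul_dotProduct]
    exact convex_Ioi (0 : ℝ) (hy u hu hum) (hz u hu hum) hs hr hsr
  · have halt : IsAlternating fun i : Fin m => homogenize x (Fin.castLE hmn.le i) :=
      fun σ hσ => hx.2 (fun j => Fin.castLE hmn.le (σ j))
        ((Fin.strictMono_castLE hmn.le).comp hσ) fun j => (σ j).2
    obtain ⟨y, hy⟩ := halt.exists_extension hd hm fun _ => rfl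
    have hmem : Function.update x ⟨m, hmn⟩ y ∈ stageSpace v (m + 1) :=
      (hiff x hx y).2 fun u hu hum => hy (fun j => ⟨u j, hum j⟩) fun i j hij => hu hij
    have hev : ∀ᶠ z in nhds x, ∀ σ : Fin (d + 1) → Fin n, StrictMono σ →
        (∀ j, (σ j : ℕ) < m + 1) →
        0 < (Matrix.of fun j => homogenize (Function.update z ⟨m, hmn⟩ y) (σ j)).det := by
      refine Filter.eventually_all.2 fun σ => ?_
      by_cases hσ : StrictMono σ ∧ ∀ j, (σ j : ℕ) < m + 1
      · have hcont := continuous_det_homogenize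
          (f := fun z : Fin n → Fin d → ℝ => Function.update z ⟨m, hmn⟩ y) (by fun_prop) σ
        exact ((hcont.tendsto x).eventually (lt_mem_nhds (hmem.2 σ hσ.1 hσ.2))).mono
          fun z hz _ _ => hz
      · exact Filter.Eventually.of_forall fun z h h' => absurd ⟨h, h'⟩ hσ
    refine ⟨y, hev.mono fun z hz hzR => ⟨fun i hi => ?_, hz⟩⟩
    have hne : i ≠ ⟨m, hmn⟩ := fun h => by
      have : (i : ℕ) = m := congrArg Fin.val h
      omega
    rw [Function.update_of_ne hne]
    exact hzR.1 i (by omega)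

theorem contractibleSpace_stageSpace {n d m : ℕ} (hd : Even d) (hm : d + 1 ≤ m) (hmn : m ≤ n)
    {v : Fin n → Fin d → ℝ} (hv : IsAlternating (homogenize v)) :
    ContractibleSpace (stageSpace v m) := by
  induction m, hm using Nat.le_induction with
  | base =>
    have h : stageSpace v (d + 1) = {v} := by
      ext x
      refine ⟨fun hx => funext fun i => hx.1 i (lt_or_ge _ _), ?_⟩
      rintro rfl
      exact ⟨fun _ _ => rfl, fun σ hσ _ => hv σ hσ⟩
    rw [h]
    infer_instance
  | succ m hm ih =>
    have := ih (by omega)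
    exact contractibleSpace_stageSpace_succ hd hm (by omega) v

/-- **Theorem 1.3 for cyclic polytopes**: for even `d ≥ 2` and `n ≥ d + 2`, the normalized
realization space of the cyclic polytope `C_d(n)` (with vertices on the moment curve and
affine basis the first `d + 1` vertices) is nonempty, open in the affine subspace of
configurations fixing the basis, and contractible. -/
theorem cyclic_polytope_realization_space (d n : ℕ) (hd : 2 ≤ d) (hdeven : Even d)
    (hn : d + 2 ≤ n) (t : Fin n → ℝ) (ht : StrictMono t) :
    letI v : Fin n → Fin d → ℝ := fun i j => t i ^ ((j : ℕ) + 1)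
    letI B : Finset (Fin n) := Finset.univ.filter fun i : Fin n => (i : ℕ) < d + 1
    (polytopeRealizationSpace v B).Nonempty ∧
    IsOpen {x : {x : Fin n → Fin d → ℝ // ∀ i ∈ B, x i = v i} |
      (x : Fin n → Fin d → ℝ) ∈ polytopeRealizationSpace v B} ∧
    ContractibleSpace ↥(polytopeRealizationSpace v B) := by
  obtain ⟨k, rfl⟩ := hdeven
  let v := momentPoints (k + k) t
  let B : Finset (Fin n) := Finset.univ.filter fun i : Fin n => (i : ℕ) < k + k + 1
  change (polytopeRealizationSpace v B).Nonempty ∧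
    IsOpen {x : {x : Fin n → Fin (k + k) → ℝ // ∀ i ∈ B, x i = v i} |
      (x : Fin n → Fin (k + k) → ℝ) ∈ polytopeRealizationSpace v B} ∧
    ContractibleSpace ↥(polytopeRealizationSpace v B)
  have hiff := mem_realizationSpace_momentPoints_iff (k := k) (by omega) hn ht (B := B)
    (fun i => by simp [B])
  have hv : IsAlternating (homogenize (momentPoints (k + k) t)) := isAlternating_momentPoints ht
  refine ⟨⟨v, (hiff v).2 ⟨fun _ _ => rfl, hv⟩⟩, ?_, ?_⟩
  · have hset : {x : {x : Fin n → Fin (k + k) → ℝ // ∀ i ∈ B, x i = v i} |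
        (x : Fin n → Fin (k + k) → ℝ) ∈ polytopeRealizationSpace v B} =
        ⋂ σ : Fin (k + k + 1) → Fin n,
          {x : {x : Fin n → Fin (k + k) → ℝ // ∀ i ∈ B, x i = v i} | StrictMono σ → 0 <
            (Matrix.of fun j => homogenize (x : Fin n → Fin (k + k) → ℝ) (σ j)).det} := by
      ext x
      simp only [Set.mem_iInter]
      exact (hiff x).trans ⟨fun h => h.2, fun h => ⟨x.2, h⟩⟩
    rw [hset]
    refine isOpen_iInter_of_finite fun σ => ?_
    by_cases hσ : StrictMono σ
    · simp only [hσ, true_imp_iff]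
      exact isOpen_lt continuous_const (continuous_det_homogenize continuous_subtype_val σ)
    · simp [hσ]
  · have hset : polytopeRealizationSpace v B = stageSpace v n := by
      ext x
      refine (hiff x).trans ⟨fun h => ⟨fun i hi => h.1 i ?_, fun σ hσ _ => h.2 σ hσ⟩,
        fun h => ⟨fun i hi => h.1 i (Or.inl (by simpa [B] using hi)),
          fun σ hσ => h.2 σ hσ fun j => (σ j).2⟩⟩
      have := i.2
      simp only [B, Finset.mem_filter, Finset.mem_univ, true_and]
      omega
    rw [hset]
    exact contractibleSpace_stageSpace ⟨k, rfl⟩ (by omega) le_rfl hv
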